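/- A d-dimensional multisequence (a_n)_{n∈ℕ^d} of complex numbers is a moment multisequence (i.e., there exists a positive Borel measure μ on ℝ^d with a_n = ∫_{ℝ^d} x^n dμ(x) for all n ∈ ℕ^d) if and only if there exists a family {μ_ξ}_{ξ∈Ξ} of positive Borel measures on ℝ^d such that: (1) a_n^ξ = ∫_{ℝ^d} x^n dμ_ξ(x) for all n ∈ N_1 ∪ 2N_1 and all ξ ∈ Ξ, and (2) μ_0 = 0 and μ_{ξ+η} + μ_{ξ−η} − 2μ_η ≥ 0 for all ξ, η ∈ Ξ. -/

import Mathlib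

open MeasureTheory Finsupp Complex

noncomputable section

/-- `x^n = ∏ i, (x i)^(n i)` as a complex number, for `x ∈ ℝ^d`, `n ∈ ℕ^d`. -/
def rmom {d : ℕ} (x : Fin d → ℝ) (n : Fin d → ℕ) : ℂ := ∏ i, (x i : ℂ) ^ n i

/-- `a_n^ξ := ∑_{k,l} a_{n+k+l} ξ_k conj(ξ_l)`. -/
def aXi {d : ℕ} (a : (Fin d → ℕ) → ℂ) (ξ : (Fin d → ℕ) →₀ ℂ) (n : Fin d → ℕ) : ℂ :=
  ∑ k ∈ ξ.support, ∑ l ∈ ξ.support, a (n + k + l) * ξ k * (starRingEnd ℂ) (ξ l)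

/-- `n ∈ N₁ ∪ 2N₁`, where `N₁ = {k ∈ ℕ^d : |k| ≤ 1}`. -/
def truncIdx {d : ℕ} (n : Fin d → ℕ) : Prop :=
  (∑ i, n i ≤ 1) ∨ ∃ k : Fin d → ℕ, (∑ i, k i ≤ 1) ∧ n = fun i => 2 * k i

/-- Almost invariant finite averages on an abelian group, for finitely many shifts. -/
theorem exists_almost_invariant_average {G : Type*} [AddCommGroup G] (N : ℕ) (hN : 0 < N)
    (S : Finset G) :
    ∃ (m : ℕ) (pt : Fin m → G), 0 < m ∧ ∀ t ∈ S, ∀ (f : G → ℝ) (C : ℝ), (∀ x, |f x| ≤ C) →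
      |∑ c, (f (pt c + t) - f (pt c))| ≤ (2 * C / N) * m := by
  classical
  induction S using Finset.induction_on with
  | empty => exact ⟨1, fun _ => 0, one_pos, by simp⟩
  | insert s S _ ih =>
    obtain ⟨m, pt, hm, h⟩ := ih
    have hN' : (0 : ℝ) < N := by exact_mod_cast hN
    refine ⟨m * N, fun c => pt (finProdFinEquiv.symm c).1 + ((finProdFinEquiv.symm c).2 : ℕ) • s,
      Nat.mul_pos hm hN, fun t ht f C hf => ?_⟩
    rw [← finProdFinEquiv.sum_comp, Fintype.sum_prod_type]
    simp only [Equiv.symm_apply_apply]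
    rcases Finset.mem_insert.1 ht with rfl | ht
    · have h1 : ∀ c : Fin m, ∑ i : Fin N,
          (f (pt c + (i : ℕ) • t + t) - f (pt c + (i : ℕ) • t)) = f (pt c + N • t) - f (pt c) := by
        intro c
        rw [Fin.sum_univ_eq_sum_range
          (fun i : ℕ => f (pt c + i • t + t) - f (pt c + i • t)) N]
        have := Finset.sum_range_sub (fun i : ℕ => f (pt c + i • t)) N
        simp only [zero_smul, add_zero] at this
        rw [← this]
        simp only [succ_nsmul, add_assoc]
      simp only [h1]
      refine (Finset.abs_sum_le_sum_abs _ _).trans ?_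
      have h2 : ∀ c ∈ (Finset.univ : Finset (Fin m)), |f (pt c + N • t) - f (pt c)| ≤ 2 * C := by
        intro c _
        have h3 := abs_le.1 (hf (pt c + N • t))
        have h4 := abs_le.1 (hf (pt c))
        exact abs_le.2 ⟨by linarith, by linarith⟩
      refine (Finset.sum_le_sum h2).trans (le_of_eq ?_)
      simp only [Finset.sum_const, Finset.card_univ, Fintype.card_fin, nsmul_eq_mul]
      push_cast
      field_simp
    · rw [Finset.sum_comm]
      refine (Finset.abs_sum_le_sum_abs _ _).trans ?_
      have h2 : ∀ i ∈ (Finset.univ : Finset (Fin N)),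
          |∑ c, (f (pt c + (i : ℕ) • s + t) - f (pt c + (i : ℕ) • s))| ≤ 2 * C / N * m := by
        intro i _
        have := h t ht (fun x => f (x + (i : ℕ) • s)) C (fun x => hf _)
        simpa only [add_right_comm] using this
      refine (Finset.sum_le_sum h2).trans (le_of_eq ?_)
      simp only [Finset.sum_const, Finset.card_univ, Fintype.card_fin, nsmul_eq_mul]
      push_cast
      ring

/-- A net of finite averages on an abelian group which is asymptotically invariant. -/
theorem exists_invariant_ultrafilter_average.{v} (G : Type v) [AddCommGroup G] :
    ∃ (J : Type v) (u : Ultrafilter J) (m : J → ℕ) (pt : ∀ j, Fin (m j) → G), (∀ j, 0 < m j) ∧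
      ∀ (t : G) (f : G → ℝ) (C : ℝ), (∀ x, |f x| ≤ C) →
        Filter.Tendsto (fun j => (m j : ℝ)⁻¹ * ∑ c, (f (pt j c + t) - f (pt j c))) u
          (nhds 0) := by
  classical
  choose m pt hm h using fun j : Finset G × ℕ =>
    exists_almost_invariant_average (j.2 + 1) j.2.succ_pos j.1
  refine ⟨Finset G × ℕ, Ultrafilter.of Filter.atTop, m, pt, hm, fun t f C hf => ?_⟩
  refine Filter.Tendsto.mono_left ?_ (Ultrafilter.of_le _)
  have hlim : Filter.Tendsto (fun j : Finset G × ℕ => 2 * C * (1 / ((j.2 : ℝ) + 1)))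
      Filter.atTop (nhds 0) := by
    have := (tendsto_one_div_add_atTop_nhds_zero_nat (𝕜 := ℝ)).const_mul (2 * C)
    rw [mul_zero] at this
    refine this.comp ?_
    rw [← Filter.prod_atTop_atTop_eq]
    exact Filter.tendsto_snd
  refine squeeze_zero_norm' ?_ hlim
  filter_upwards [Filter.eventually_ge_atTop (({t} : Finset G), 0)] with j hj
  have hj1 : t ∈ j.1 := hj.1 (Finset.mem_singleton_self t)
  have hmj : (0 : ℝ) < m j := by exact_mod_cast hm j
  have := h j t hj1 f C hf
  rw [Real.norm_eq_abs, abs_mul, abs_of_pos (inv_pos.2 hmj), inv_mul_le_iff₀ hmj]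
  refine this.trans (le_of_eq ?_)
  push_cast
  ring

section Parallelogram

variable {G : Type*} [AddCommGroup G] {h : G → ℝ}

theorem parallelogram_zero (hp : ∀ x y, h (x + y) + h (x - y) = 2 * h x + 2 * h y) : h 0 = 0 := by
  have := hp 0 0
  simp only [add_zero, sub_zero] at this
  linarith

theorem parallelogram_neg (hp : ∀ x y, h (x + y) + h (x - y) = 2 * h x + 2 * h y) (x : G) :
    h (-x) = h x := by
  have := hp 0 x
  simp only [zero_add, zero_sub, parallelogram_zero hp] at this
  linarith

/-- Polarization of a function satisfying the parallelogram law is biadditive. -/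
theorem parallelogram_polar_add (hp : ∀ x y, h (x + y) + h (x - y) = 2 * h x + 2 * h y)
    (u v z : G) :
    h (u + v + z) - h (u + v - z) = (h (u + z) - h (u - z)) + (h (v + z) - h (v - z)) := by
  have key : ∀ x y, (h (x + y + z) - h (x + y - z)) + (h (x - y + z) - h (x - y - z)) =
      2 * (h (x + z) - h (x - z)) := by
    intro x y
    have h1 := hp (x + z) y
    have h2 := hp (x - z) y
    rw [show x + z + y = x + y + z by abel, show x + z - y = x - y + z by abel] at h1
    rw [show x - z + y = x + y - z by abel, show x - z - y = x - y - z by abel] at h2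
    linarith
  have dbl : ∀ x, h (x + x + z) - h (x + x - z) = 2 * (h (x + z) - h (x - z)) := by
    intro x
    have h1 := key x x
    have h2 := parallelogram_neg hp z
    simp only [sub_self, zero_add, zero_sub] at h1
    linarith
  have h1 := key (u + v) (u - v)
  rw [show u + v + (u - v) = u + u by abel, show u + v - (u - v) = v + v by abel,
    dbl, dbl] at h1
  linarith

/-- The biadditive form (four times the usual one) attached to a function satisfying the
parallelogram law. -/
def parallelogramForm (hp : ∀ x y, h (x + y) + h (x - y) = 2 * h x + 2 * h y) : G →+ G →+ ℝ :=
  AddMonoidHom.mk' (fun x => AddMonoidHom.mk' (fun y => h (x + y) - h (x - y)) (by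
    intro u v
    have hs : ∀ w : G, h (x + w) - h (x - w) = h (w + x) - h (w - x) := fun w => by
      rw [add_comm x w, ← parallelogram_neg hp (w - x), neg_sub]
    rw [hs, hs, hs]
    exact parallelogram_polar_add hp u v x)) (by
    intro u v
    ext z
    exact parallelogram_polar_add hp u v z)

theorem parallelogramForm_apply (hp : ∀ x y, h (x + y) + h (x - y) = 2 * h x + 2 * h y)
    (x y : G) : parallelogramForm hp x y = h (x + y) - h (x - y) := rfl

theorem parallelogramForm_symm (hp : ∀ x y, h (x + y) + h (x - y) = 2 * h x + 2 * h y)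
    (x y : G) : parallelogramForm hp x y = parallelogramForm hp y x := by
  rw [parallelogramForm_apply, parallelogramForm_apply, add_comm x y,
    ← parallelogram_neg hp (y - x), neg_sub]

theorem parallelogramForm_self (hp : ∀ x y, h (x + y) + h (x - y) = 2 * h x + 2 * h y)
    (x : G) : parallelogramForm hp x x = 4 * h x := by
  have h1 := hp x x
  rw [parallelogramForm_apply]
  simp only [sub_self, parallelogram_zero hp] at h1 ⊢
  linarith

theorem ternary_form_nonneg_of_int {A B C D E F : ℝ}
    (hint : ∀ a b c : ℤ, 0 ≤ (a : ℝ) ^ 2 * A + (b : ℝ) ^ 2 * B + (c : ℝ) ^ 2 * C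
      + 2 * a * b * D + 2 * a * c * E + 2 * b * c * F) (a b c : ℝ) :
    0 ≤ a ^ 2 * A + b ^ 2 * B + c ^ 2 * C + 2 * a * b * D + 2 * a * c * E + 2 * b * c * F := by
  have hrat : ∀ a b c : ℚ, 0 ≤ (a : ℝ) ^ 2 * A + (b : ℝ) ^ 2 * B + (c : ℝ) ^ 2 * C
      + 2 * a * b * D + 2 * a * c * E + 2 * b * c * F := by
    intro a b c
    have hq := hint (a.num * b.den * c.den) (b.num * a.den * c.den) (c.num * a.den * b.den)
    have ha : (a.den : ℝ) ≠ 0 := by exact_mod_cast a.den_nz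
    have hb : (b.den : ℝ) ≠ 0 := by exact_mod_cast b.den_nz
    have hc : (c.den : ℝ) ≠ 0 := by exact_mod_cast c.den_nz
    have hpos : 0 < ((a.den : ℝ) * b.den * c.den) ^ 2 := by positivity
    refine nonneg_of_mul_nonneg_right (a := ((a.den : ℝ) * b.den * c.den) ^ 2) ?_ hpos
    refine hq.trans (le_of_eq ?_)
    rw [Rat.cast_def a, Rat.cast_def b, Rat.cast_def c]
    push_cast
    field_simp
  have h1 : ∀ (a : ℝ) (b c : ℚ), 0 ≤ a ^ 2 * A + (b : ℝ) ^ 2 * B + (c : ℝ) ^ 2 * C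
      + 2 * a * b * D + 2 * a * c * E + 2 * b * c * F := fun a b c =>
    Rat.denseRange_cast.induction_on a
      (isClosed_le continuous_const (by fun_prop)) (fun a => hrat a b c)
  have h2 : ∀ (a b : ℝ) (c : ℚ), 0 ≤ a ^ 2 * A + b ^ 2 * B + (c : ℝ) ^ 2 * C
      + 2 * a * b * D + 2 * a * c * E + 2 * b * c * F := fun a b c =>
    Rat.denseRange_cast.induction_on b
      (isClosed_le continuous_const (by fun_prop)) (fun b => h1 a b c)
  exact Rat.denseRange_cast.induction_on c
      (isClosed_le continuous_const (by fun_prop)) (fun c => h2 a b c)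

theorem parallelogramForm_ternary_nonneg
    (hp : ∀ x y, h (x + y) + h (x - y) = 2 * h x + 2 * h y)
    (hnn : ∀ x, 0 ≤ h x) (p q r : G) (a b c : ℝ) :
    0 ≤ a ^ 2 * (4 * h p) + b ^ 2 * (4 * h q) + c ^ 2 * (4 * h r)
      + 2 * a * b * parallelogramForm hp p q + 2 * a * c * parallelogramForm hp p r
      + 2 * b * c * parallelogramForm hp q r := by
  refine ternary_form_nonneg_of_int (fun a b c => ?_) a b c
  have h1 : 0 ≤ 4 * h (a • p + b • q + c • r) := mul_nonneg (by norm_num) (hnn _)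
  rw [← parallelogramForm_self hp] at h1
  simp only [map_add, map_zsmul, AddMonoidHom.add_apply, AddMonoidHom.smul_apply,
    zsmul_eq_mul, parallelogramForm_self hp,
    parallelogramForm_symm hp q p, parallelogramForm_symm hp r p,
    parallelogramForm_symm hp r q] at h1
  refine h1.trans (le_of_eq ?_)
  ring

/-- A null vector `t p - q` of the form is orthogonal to everything. -/
theorem parallelogramForm_eq_of_null
    (hp : ∀ x y, h (x + y) + h (x - y) = 2 * h x + 2 * h y)
    (hnn : ∀ x, 0 ≤ h x) {p q : G} {t : ℝ}
    (h0 : t ^ 2 * (4 * h p) - 2 * t * parallelogramForm hp p q + 4 * h q = 0) (r : G) :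
    t * parallelogramForm hp p r = parallelogramForm hp q r := by
  set L := t * parallelogramForm hp p r - parallelogramForm hp q r with hL
  have key : ∀ c : ℝ, 0 ≤ c ^ 2 * (4 * h r) + 2 * c * L := by
    intro c
    have := parallelogramForm_ternary_nonneg hp hnn p q r t (-1) c
    rw [hL]
    nlinarith
  have hR : 0 ≤ 4 * h r := mul_nonneg (by norm_num) (hnn r)
  have hk := key (-L / (4 * h r + 1))
  have hd : 0 < 4 * h r + 1 := by linarith
  have : (-L / (4 * h r + 1)) ^ 2 * (4 * h r) + 2 * (-L / (4 * h r + 1)) * L =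
      -(L ^ 2 * (4 * h r + 2)) / (4 * h r + 1) ^ 2 := by
    field_simp
    ring
  rw [this, div_nonneg_iff] at hk
  have hL0 : L = 0 := by
    have h5 : 0 < (4 * h r + 1) ^ 2 := by positivity
    rcases hk with hk | hk
    · have : L ^ 2 * (4 * h r + 2) ≤ 0 := by linarith [hk.1]
      have h6 : L ^ 2 ≤ 0 := by nlinarith [sq_nonneg L]
      exact pow_eq_zero_iff (two_ne_zero) |>.1 (le_antisymm h6 (sq_nonneg L))
    · linarith [hk.2]
  linarith

end Parallelogram

section WeakLimits

open scoped BoundedContinuousFunction NNReal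

theorem moments_of_weak_limit {X J : Type*} [TopologicalSpace X] [MeasurableSpace X]
    [BorelSpace X] {u : Filter J} [u.NeBot] {A : J → Measure X}
    {F : Measure X} [IsFiniteMeasure F] [∀ j, IsFiniteMeasure (A j)]
    (hlim : ∀ f : X →ᵇ ℝ, Filter.Tendsto (fun j => ∫ x, f x ∂(A j)) u (nhds (∫ x, f x ∂F)))
    {y : X → ℝ} (hy : Continuous y) {m₁ m₂ : ℝ}
    (h1 : ∀ j, Integrable y (A j)) (h1' : ∀ j, ∫ x, y x ∂(A j) = m₁)
    (h2 : ∀ j, Integrable (fun x => y x ^ 2) (A j)) (h2' : ∀ j, ∫ x, y x ^ 2 ∂(A j) = m₂) :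
    Integrable y F ∧ ∫ x, y x ∂F = m₁ ∧ Integrable (fun x => y x ^ 2) F ∧
      ∫ x, y x ^ 2 ∂F ≤ m₂ := by
  have hm2 : 0 ≤ m₂ := by
    obtain ⟨j⟩ := u.nonempty_of_neBot
    rw [← h2' j]
    exact integral_nonneg fun x => sq_nonneg _
  -- truncated second moments
  have hsq : ∀ R : ℕ, ∫ x, min (y x ^ 2) (R : ℝ) ∂F ≤ m₂ := by
    intro R
    have hb : ∀ x, ‖min (y x ^ 2) (R : ℝ)‖ ≤ R := fun x => by
      rw [Real.norm_of_nonneg (le_min (sq_nonneg _) (Nat.cast_nonneg R))]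
      exact min_le_right _ _
    let f : X →ᵇ ℝ := BoundedContinuousFunction.ofNormedAddCommGroup
      (fun x => min (y x ^ 2) (R : ℝ)) (by fun_prop) R hb
    refine le_of_tendsto (hlim f) (Filter.Eventually.of_forall fun j => ?_)
    rw [← h2' j]
    exact integral_mono (f.integrable (A j)) (h2 j) fun x => min_le_left _ _
  have hlint : ∫⁻ x, ENNReal.ofReal (y x ^ 2) ∂F ≤ ENNReal.ofReal m₂ := by
    have hmono : Filter.Tendsto
        (fun R : ℕ => ∫⁻ x, ENNReal.ofReal (min (y x ^ 2) (R : ℝ)) ∂F) Filter.atTop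
        (nhds (∫⁻ x, ENNReal.ofReal (y x ^ 2) ∂F)) := by
      refine lintegral_tendsto_of_tendsto_of_monotone
        (fun R => (ENNReal.continuous_ofReal.comp (by fun_prop :
          Continuous fun x => min (y x ^ 2) (R : ℝ))).measurable.aemeasurable) ?_ ?_
      · refine Filter.Eventually.of_forall fun x R R' hR => ENNReal.ofReal_le_ofReal ?_
        exact min_le_min_left _ (by exact_mod_cast hR)
      · refine Filter.Eventually.of_forall fun x => tendsto_const_nhds.congr' ?_
        filter_upwards [Filter.eventually_ge_atTop ⌈y x ^ 2⌉₊] with R hR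
        rw [min_eq_left ((Nat.le_ceil _).trans (by exact_mod_cast hR))]
    refine le_of_tendsto hmono (Filter.Eventually.of_forall fun R => ?_)
    rw [← ofReal_integral_eq_lintegral_ofReal]
    · exact ENNReal.ofReal_le_ofReal (hsq R)
    · refine Integrable.of_bound (C := R)
        (by fun_prop : Continuous fun x => min (y x ^ 2) (R : ℝ)).aestronglyMeasurable
        (Filter.Eventually.of_forall fun x => ?_)
      rw [Real.norm_of_nonneg (le_min (sq_nonneg _) (Nat.cast_nonneg R))]
      exact min_le_right _ _
    · exact Filter.Eventually.of_forall fun x => le_min (sq_nonneg _) (Nat.cast_nonneg R)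
  have hi2 : Integrable (fun x => y x ^ 2) F := by
    refine ⟨(hy.pow 2).aestronglyMeasurable, ?_⟩
    rw [hasFiniteIntegral_iff_ofReal (Filter.Eventually.of_forall fun x => sq_nonneg _)]
    exact hlint.trans_lt ENNReal.ofReal_lt_top
  have hi2' : ∫ x, y x ^ 2 ∂F ≤ m₂ := by
    rw [← ofReal_integral_eq_lintegral_ofReal hi2
      (Filter.Eventually.of_forall fun x => sq_nonneg _)] at hlint
    exact (ENNReal.ofReal_le_ofReal_iff hm2).1 hlint
  have hi1 : Integrable y F := by
    refine (hi2.add (integrable_const (1 : ℝ))).mono' hy.aestronglyMeasurable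
      (Filter.Eventually.of_forall fun x => ?_)
    simp only [Pi.add_apply, Real.norm_eq_abs]
    nlinarith [sq_abs (y x), sq_nonneg (|y x| - 1)]
  refine ⟨hi1, ?_, hi2, hi2'⟩
  -- clamped first moments
  have hclamp : ∀ R : ℝ, 0 < R → |∫ x, y x ∂F - m₁| ≤ 2 * m₂ / R := by
    intro R hR
    have hb : ∀ x, ‖max (-R) (min (y x) R)‖ ≤ R := fun x => by
      rw [Real.norm_eq_abs, abs_le]
      exact ⟨le_max_left _ _, max_le (by linarith) (min_le_right _ _)⟩
    let f : X →ᵇ ℝ := BoundedContinuousFunction.ofNormedAddCommGroup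
      (fun x => max (-R) (min (y x) R)) (by fun_prop) R hb
    have hdiff : ∀ x, |y x - f x| ≤ y x ^ 2 / R := by
      intro x
      change |y x - max (-R) (min (y x) R)| ≤ y x ^ 2 / R
      rw [le_div_iff₀ hR]
      rcases le_total (y x) R with h | h
      · rw [min_eq_left h]
        rcases le_total (-R) (y x) with h' | h'
        · rw [max_eq_right h', sub_self, abs_zero, zero_mul]
          positivity
        · rw [max_eq_left h', abs_of_nonpos (by linarith)]
          nlinarith
      · rw [min_eq_right h, max_eq_right (by linarith), abs_of_nonneg (by linarith)]
        nlinarith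
    have hint : ∀ (ν : Measure X) [IsFiniteMeasure ν], Integrable y ν →
        Integrable (fun x => y x ^ 2) ν → ∫ x, y x ^ 2 ∂ν ≤ m₂ →
        |∫ x, y x ∂ν - ∫ x, f x ∂ν| ≤ m₂ / R := by
      intro ν _ hν1 hν2 hν3
      rw [← integral_sub hν1 (f.integrable ν)]
      refine (abs_integral_le_integral_abs).trans ?_
      refine (integral_mono (hν1.sub (f.integrable ν)).abs (hν2.div_const R) hdiff).trans ?_
      rw [integral_div]
      gcongr
    have hA : |m₁ - ∫ x, f x ∂F| ≤ m₂ / R := by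
      refine le_of_tendsto ((tendsto_const_nhds.sub (hlim f)).abs)
        (Filter.Eventually.of_forall fun j => ?_)
      rw [← h1' j]
      exact hint (A j) (h1 j) (h2 j) (h2' j).le
    have hF := hint F hi1 hi2 hi2'
    have e : 2 * m₂ / R = m₂ / R + m₂ / R := by ring
    rw [abs_le] at hA hF ⊢
    constructor <;> linarith [hA.1, hA.2, hF.1, hF.2]
  have h0 : |∫ x, y x ∂F - m₁| ≤ 0 := by
    have ht : Filter.Tendsto (fun R : ℝ => 2 * m₂ / R) Filter.atTop (nhds 0) :=
      tendsto_const_nhds.div_atTop Filter.tendsto_id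
    refine ge_of_tendsto ht ?_
    filter_upwards [Filter.eventually_gt_atTop 0] with R hR using hclamp R hR
  linarith [abs_eq_zero.1 (le_antisymm h0 (abs_nonneg _))]

/-- Compactness: measures on `ℝ^d` with fixed mass, first and second moments have weak limits
along ultrafilters. -/
theorem exists_weak_limit {d : ℕ} {J : Type*} (u : Ultrafilter J) (A : J → Measure (Fin d → ℝ))
    [∀ j, IsFiniteMeasure (A j)] (m₀ : ℝ) (m₂ : Fin d → ℝ)
    (h0 : ∀ j, (A j).real Set.univ = m₀)
    (h2 : ∀ j i, Integrable (fun x : Fin d → ℝ => x i ^ 2) (A j))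
    (h2' : ∀ j i, ∫ x, x i ^ 2 ∂(A j) = m₂ i) :
    ∃ F : Measure (Fin d → ℝ), IsFiniteMeasure F ∧
      ∀ f : (Fin d → ℝ) →ᵇ ℝ,
        Filter.Tendsto (fun j => ∫ x, f x ∂(A j)) u (nhds (∫ x, f x ∂F)) := by
  obtain ⟨j₀⟩ := (u : Filter J).nonempty_of_neBot
  have hm0 : 0 ≤ m₀ := by rw [← h0 j₀]; exact measureReal_nonneg
  have hm2 : 0 ≤ ∑ i, m₂ i := Finset.sum_nonneg fun i _ => by
    rw [← h2' j₀ i]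
    exact integral_nonneg fun x => sq_nonneg _
  let w : ℕ → ℝ≥0 := fun n => ⟨(∑ i, m₂ i) / (n + 1), by positivity⟩
  have hw : Filter.Tendsto w Filter.atTop (nhds 0) := by
    rw [← NNReal.tendsto_coe]
    have := (tendsto_one_div_add_atTop_nhds_zero_nat (𝕜 := ℝ)).const_mul (∑ i, m₂ i)
    rw [mul_zero] at this
    refine this.congr fun n => ?_
    change _ = (∑ i, m₂ i) / ((n : ℝ) + 1)
    ring
  have hc := isCompact_setOfPred_finiteMeasure_mass_le_compl_isCompact_le
    (E := Fin d → ℝ) (u := w) (K := fun n : ℕ => Metric.closedBall 0 ((n : ℝ) + 1))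
    ⟨m₀, hm0⟩ hw (fun n => isCompact_closedBall _ _) (Or.inl inferInstance)
  let B : J → FiniteMeasure (Fin d → ℝ) := fun j => ⟨A j, inferInstance⟩
  have hB : ∀ j, (B j).mass ≤ ⟨m₀, hm0⟩ ∧ ∀ n : ℕ,
      B j (Metric.closedBall 0 ((n : ℝ) + 1))ᶜ ≤ w n := by
    intro j
    refine ⟨NNReal.coe_le_coe.1 ((h0 j).le), fun n => NNReal.coe_le_coe.1 ?_⟩
    change (A j).real _ ≤ (∑ i, m₂ i) / ((n : ℝ) + 1)
    have hn : (0 : ℝ) < n + 1 := by positivity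
    have hM := mul_meas_ge_le_integral_of_nonneg (μ := A j)
      (f := fun x : Fin d → ℝ => ∑ i, x i ^ 2)
      (Filter.Eventually.of_forall fun x => Finset.sum_nonneg fun i _ => sq_nonneg _)
      (integrable_finsetSum _ fun i _ => h2 j i) ((n : ℝ) + 1)
    rw [integral_finsetSum _ fun i _ => h2 j i] at hM
    simp only [h2'] at hM
    rw [le_div_iff₀ hn, mul_comm]
    refine le_trans (mul_le_mul_of_nonneg_left (measureReal_mono ?_) hn.le) hM
    intro x hx
    rw [Set.mem_compl_iff, mem_closedBall_zero_iff, pi_norm_le_iff_of_nonneg hn.le] at hx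
    push Not at hx
    obtain ⟨i, hi⟩ := hx
    change (n : ℝ) + 1 ≤ ∑ i, x i ^ 2
    refine le_trans ?_ (Finset.single_le_sum (f := fun i => x i ^ 2)
      (fun i _ => sq_nonneg _) (Finset.mem_univ i))
    rw [Real.norm_eq_abs] at hi
    have h3 := sq_abs (x i)
    have hn' : (0 : ℝ) ≤ n := n.cast_nonneg
    nlinarith
  obtain ⟨F, -, hF⟩ := hc.ultrafilter_le_nhds (u.map B) (by
    rw [Filter.le_principal_iff]
    exact Filter.mem_map.2 (Filter.Eventually.of_forall hB))
  refine ⟨F, inferInstance, ?_⟩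
  exact FiniteMeasure.tendsto_iff_forall_integral_tendsto.1 (show Filter.Tendsto B u (nhds F) from hF)

theorem integrable_integral_measure_sub {X : Type*} [MeasurableSpace X] {ρ κ : Measure X}
    [IsFiniteMeasure κ] (hle : κ ≤ ρ) {f : X → ℝ} (hf : Integrable f ρ) :
    Integrable f (ρ - κ) ∧ ∫ x, f x ∂(ρ - κ) = ∫ x, f x ∂ρ - ∫ x, f x ∂κ := by
  have h1 : Integrable f (ρ - κ) := hf.mono_measure Measure.sub_le
  have h2 : Integrable f κ := hf.mono_measure hle
  refine ⟨h1, ?_⟩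
  rw [eq_sub_iff_add_eq, ← integral_add_measure h1 h2, Measure.sub_add_cancel_of_le hle]

/-- Averaging the second differences of a midpoint convex family of measures, dominated by
quadratic moments, yields a family of measures obeying the parallelogram law. -/
theorem exists_parallelogram_family {d : ℕ} {G : Type*} [AddCommGroup G]
    (μ : G → Measure (Fin d → ℝ)) [∀ g, IsFiniteMeasure (μ g)]
    (hconv : ∀ ξ η, μ η + μ η ≤ μ (η + ξ) + μ (η - ξ))
    (hi1 : ∀ g i, Integrable (fun x : Fin d → ℝ => x i) (μ g))
    (hi2 : ∀ g i, Integrable (fun x : Fin d → ℝ => x i ^ 2) (μ g))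
    (hp0 : ∀ ξ η, (μ (ξ + η)).real Set.univ + (μ (ξ - η)).real Set.univ =
      2 * (μ ξ).real Set.univ + 2 * (μ η).real Set.univ)
    (hp1 : ∀ i ξ η, ∫ x, x i ∂(μ (ξ + η)) + ∫ x, x i ∂(μ (ξ - η)) =
      2 * ∫ x, x i ∂(μ ξ) + 2 * ∫ x, x i ∂(μ η))
    (hp2 : ∀ i ξ η, ∫ x, x i ^ 2 ∂(μ (ξ + η)) + ∫ x, x i ^ 2 ∂(μ (ξ - η)) =
      2 * ∫ x, x i ^ 2 ∂(μ ξ) + 2 * ∫ x, x i ^ 2 ∂(μ η)) :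
    ∃ F : G → Measure (Fin d → ℝ), (∀ g, IsFiniteMeasure (F g)) ∧
      (∀ ξ η, F (ξ + η) + F (ξ - η) = F ξ + F ξ + (F η + F η)) ∧
      (∀ g, (F g).real Set.univ = (μ g).real Set.univ) ∧
      ∀ g i, Integrable (fun x : Fin d → ℝ => x i) (F g) ∧
        ∫ x, x i ∂(F g) = ∫ x, x i ∂(μ g) ∧
        Integrable (fun x : Fin d → ℝ => x i ^ 2) (F g) ∧
        ∫ x, x i ^ 2 ∂(F g) ≤ ∫ x, x i ^ 2 ∂(μ g) := by
  obtain ⟨J, u, m, pt, hm, hinv⟩ := exists_invariant_ultrafilter_average G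
  let ν : G → G → Measure (Fin d → ℝ) := fun ξ η =>
    (μ (η + ξ) + μ (η - ξ)) - (μ η + μ η)
  have hν : ∀ {f : (Fin d → ℝ) → ℝ}, (∀ g, Integrable f (μ g)) → ∀ ξ η,
      Integrable f (ν ξ η) ∧ ∫ x, f x ∂(ν ξ η) =
        ∫ x, f x ∂(μ (η + ξ)) + ∫ x, f x ∂(μ (η - ξ)) - 2 * ∫ x, f x ∂(μ η) := by
    intro f hf ξ η
    have h := integrable_integral_measure_sub (hconv ξ η)
      ((hf (η + ξ)).add_measure (hf (η - ξ)))
    refine ⟨h.1, h.2.trans ?_⟩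
    rw [integral_add_measure (hf _) (hf _), integral_add_measure (hf _) (hf _)]
    ring
  let A : G → J → Measure (Fin d → ℝ) := fun ξ j =>
    ∑ c, ((2 * (m j : ℝ≥0))⁻¹) • ν ξ (pt j c)
  have hνfin : ∀ ξ η, IsFiniteMeasure (ν ξ η) := fun ξ η => by
    dsimp only [ν]; infer_instance
  have hAfin : ∀ ξ j, IsFiniteMeasure (A ξ j) := fun ξ j => by
    dsimp only [A]; infer_instance
  have hA : ∀ {f : (Fin d → ℝ) → ℝ}, (∀ g, Integrable f (μ g)) → ∀ ξ j,
      Integrable f (A ξ j) ∧ ∫ x, f x ∂(A ξ j) =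
        (2 * (m j : ℝ))⁻¹ * ∑ c, (∫ x, f x ∂(μ (pt j c + ξ)) + ∫ x, f x ∂(μ (pt j c - ξ))
          - 2 * ∫ x, f x ∂(μ (pt j c))) := by
    intro f hf ξ j
    have hi : ∀ c ∈ (Finset.univ : Finset (Fin (m j))),
        Integrable f (((2 * (m j : ℝ≥0))⁻¹) • ν ξ (pt j c)) := fun c _ =>
      (hν hf ξ (pt j c)).1.smul_measure_nnreal
    refine ⟨integrable_finsetSum_measure.2 hi, ?_⟩
    rw [integral_finsetSum_measure hi, Finset.mul_sum]
    refine Finset.sum_congr rfl fun c _ => ?_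
    rw [integral_smul_nnreal_measure, (hν hf ξ (pt j c)).2, NNReal.smul_def, smul_eq_mul]
    push_cast
    rfl
  have hAq : ∀ {f : (Fin d → ℝ) → ℝ}, (∀ g, Integrable f (μ g)) →
      (∀ ξ η, ∫ x, f x ∂(μ (ξ + η)) + ∫ x, f x ∂(μ (ξ - η)) =
        2 * ∫ x, f x ∂(μ ξ) + 2 * ∫ x, f x ∂(μ η)) → ∀ ξ j,
      ∫ x, f x ∂(A ξ j) = ∫ x, f x ∂(μ ξ) := by
    intro f hf hp ξ j
    have hmj : (m j : ℝ) ≠ 0 := by exact_mod_cast (hm j).ne'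
    rw [(hA hf ξ j).2]
    simp only [hp, add_sub_cancel_left, Finset.sum_const, Finset.card_univ, Fintype.card_fin,
      nsmul_eq_mul]
    field_simp
  have hone : ∀ ξ j, (A ξ j).real Set.univ = (μ ξ).real Set.univ := by
    intro ξ j
    have := hAq (f := fun _ => 1) (fun g => integrable_const _) (by simpa using hp0) ξ j
    simpa using this
  have hex : ∀ ξ, ∃ F : Measure (Fin d → ℝ), IsFiniteMeasure F ∧
      ∀ f : (Fin d → ℝ) →ᵇ ℝ,
        Filter.Tendsto (fun j => ∫ x, f x ∂(A ξ j)) u (nhds (∫ x, f x ∂F)) := fun ξ =>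
    exists_weak_limit u (A ξ) _ (fun i => ∫ x, x i ^ 2 ∂(μ ξ)) (hone ξ)
      (fun j i => (hA (fun g => hi2 g i) ξ j).1)
      (fun j i => hAq (fun g => hi2 g i) (hp2 i) ξ j)
  choose F hFfin hF using hex
  refine ⟨F, hFfin, fun ξ η => ?_, fun g => ?_, fun g i => ?_⟩
  · refine ext_of_forall_integral_eq_of_IsFiniteMeasure fun f => ?_
    have hfi : ∀ (κ : Measure (Fin d → ℝ)) [IsFiniteMeasure κ], Integrable f κ :=
      fun κ _ => f.integrable κ
    have hfμ : ∀ g, Integrable f (μ g) := fun g => hfi _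
    rw [integral_add_measure (hfi _) (hfi _), integral_add_measure (hfi _) (hfi _),
      integral_add_measure (hfi _) (hfi _), integral_add_measure (hfi _) (hfi _)]
    rw [← sub_eq_zero]
    have hl := ((hF (ξ + η) f).add (hF (ξ - η) f)).sub
      (((hF ξ f).add (hF ξ f)).add ((hF η f).add (hF η f)))
    refine tendsto_nhds_unique hl ?_
    let D : G → ℝ := fun x =>
      ∫ y, f y ∂(μ (x + ξ)) + ∫ y, f y ∂(μ (x - ξ)) - 2 * ∫ y, f y ∂(μ x)
    have hD : ∀ x, |D x| ≤ ‖f‖ * (2 * (μ ξ).real Set.univ) := by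
      intro x
      have h1 : D x = ∫ y, f y ∂(ν ξ x) := ((hν hfμ ξ x).2).symm
      have h2 : (ν ξ x).real Set.univ = 2 * (μ ξ).real Set.univ := by
        have := (hν (f := fun _ => 1) (fun g => integrable_const _) ξ x).2
        simp only [integral_const, smul_eq_mul, mul_one] at this
        rw [this]
        linarith [hp0 x ξ]
      rw [h1, ← h2, ← Real.norm_eq_abs]
      exact norm_integral_le_of_norm_le_const (Filter.Eventually.of_forall f.norm_coe_le_norm)
    have ht := ((hinv η D _ hD).add (hinv (-η) D _ hD)).const_mul (2⁻¹ : ℝ)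
    simp only [add_zero, mul_zero] at ht
    refine ht.congr fun j => ?_
    rw [(hA hfμ _ j).2, (hA hfμ _ j).2, (hA hfμ _ j).2, (hA hfμ _ j).2]
    simp only [← mul_add, ← mul_sub, ← Finset.sum_add_distrib, ← Finset.sum_sub_distrib]
    rw [← mul_assoc, ← mul_inv]
    congr 1
    refine Finset.sum_congr rfl fun c _ => ?_
    have e1 : pt j c + η + ξ = pt j c + (ξ + η) := by abel
    have e2 : pt j c + η - ξ = pt j c - (ξ - η) := by abel
    have e3 : pt j c - η + ξ = pt j c + (ξ - η) := by abel
    have e4 : pt j c - η - ξ = pt j c - (ξ + η) := by abel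
    simp only [D, ← sub_eq_add_neg, e1, e2, e3, e4]
    ring
  · have h1 := hF g (BoundedContinuousFunction.const _ (1 : ℝ))
    simp only [BoundedContinuousFunction.const_apply, integral_const, smul_eq_mul, mul_one,
      hone] at h1
    exact tendsto_nhds_unique h1 tendsto_const_nhds
  · exact moments_of_weak_limit (hF g) (continuous_apply i)
      (fun j => (hA (fun g => hi1 g i) g j).1) (hAq (fun g => hi1 g i) (hp1 i) g)
      (fun j => (hA (fun g => hi2 g i) g j).1) (hAq (fun g => hi2 g i) (hp2 i) g)

/-- Simultaneous densities of a countable family of measures obeying the parallelogram law. -/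
theorem exists_parallelogram_density {X G : Type*} [MeasurableSpace X] [AddCommGroup G]
    [Countable G] (F : G → Measure X) [∀ g, IsFiniteMeasure (F g)]
    (hF : ∀ ξ η, F (ξ + η) + F (ξ - η) = F ξ + F ξ + (F η + F η)) :
    ∃ (ρ : Measure X) (h : G → X → ℝ), (∀ g x, 0 ≤ h g x) ∧
      (∀ g (f : X → ℝ), Integrable (fun x => h g x * f x) ρ ↔ Integrable f (F g)) ∧
      (∀ g (f : X → ℝ), ∫ x, h g x * f x ∂ρ = ∫ x, f x ∂(F g)) ∧
      ∀ᵐ x ∂ρ, ∀ ξ η, h (ξ + η) x + h (ξ - η) x = 2 * h ξ x + 2 * h η x := by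
  let ρ := (Measure.sum F).toFinite
  have hac : ∀ g, F g ≪ ρ := fun g =>
    (Measure.le_sum F g).absolutelyContinuous.trans (absolutelyContinuous_toFinite _)
  refine ⟨ρ, fun g x => ((F g).rnDeriv ρ x).toReal, fun g x => ENNReal.toReal_nonneg,
    fun g f => integrable_rnDeriv_smul_iff (hac g), fun g f => integral_rnDeriv_smul (hac g), ?_⟩
  have hfin : ∀ᵐ x ∂ρ, ∀ g, (F g).rnDeriv ρ x < ⊤ :=
    ae_all_iff.2 fun g => Measure.rnDeriv_lt_top _ _
  have hpar : ∀ᵐ x ∂ρ, ∀ ξ η, (F (ξ + η)).rnDeriv ρ x + (F (ξ - η)).rnDeriv ρ x =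
      (F ξ).rnDeriv ρ x + (F ξ).rnDeriv ρ x + ((F η).rnDeriv ρ x + (F η).rnDeriv ρ x) := by
    refine ae_all_iff.2 fun ξ => ae_all_iff.2 fun η => ?_
    have h0 := Measure.rnDeriv_add (F (ξ + η)) (F (ξ - η)) ρ
    have h1 := Measure.rnDeriv_add (F ξ + F ξ) (F η + F η) ρ
    have h2 := Measure.rnDeriv_add (F ξ) (F ξ) ρ
    have h3 := Measure.rnDeriv_add (F η) (F η) ρ
    rw [hF ξ η] at h0
    filter_upwards [h0, h1, h2, h3] with x g0 g1 g2 g3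
    simp only [Pi.add_apply] at g0 g1 g2 g3
    rw [← g0, g1, g2, g3]
  filter_upwards [hfin, hpar] with x hx hp ξ η
  have := congrArg ENNReal.toReal (hp ξ η)
  have ht : ∀ g, (F g).rnDeriv ρ x ≠ ⊤ := fun g => (hx g).ne
  rw [ENNReal.toReal_add (ht _) (ht _),
    ENNReal.toReal_add (ENNReal.add_ne_top.2 ⟨ht _, ht _⟩) (ENNReal.add_ne_top.2 ⟨ht _, ht _⟩),
    ENNReal.toReal_add (ht _) (ht _), ENNReal.toReal_add (ht _) (ht _)] at this
  linarith

/-- A parallelogram family of measures in which multiplication by `x i` acts as the shift by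
the `i`-th unit vector represents all moments. -/
theorem moments_of_parallelogram_family {d : ℕ}
    (F : ((Fin d → ℕ) →₀ ℤ) → Measure (Fin d → ℝ)) [∀ g, IsFiniteMeasure (F g)]
    (hF : ∀ ξ η, F (ξ + η) + F (ξ - η) = F ξ + F ξ + (F η + F η))
    (hi1 : ∀ g i, Integrable (fun x : Fin d → ℝ => x i) (F g))
    (hi2 : ∀ g i, Integrable (fun x : Fin d → ℝ => x i ^ 2) (F g))
    (hnull : ∀ (n : Fin d → ℕ) (i : Fin d),
      4 * ∫ x, x i ^ 2 ∂(F (single n 1)) -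
        2 * (∫ x, x i ∂(F (single n 1 + single (n + Pi.single i 1) 1)) -
          ∫ x, x i ∂(F (single n 1 - single (n + Pi.single i 1) 1))) +
        4 * (F (single (n + Pi.single i 1) 1)).real Set.univ ≤ 0) (n : Fin d → ℕ) :
    Integrable (fun x : Fin d → ℝ => ∏ i, x i ^ n i) (F (single 0 1)) ∧
      (F (single n 1 + single 0 1)).real Set.univ - (F (single n 1 - single 0 1)).real Set.univ =
        4 * ∫ x, ∏ i, x i ^ n i ∂(F (single 0 1)) := by
  obtain ⟨ρ, h, hnn, hint, hval, hpar⟩ := exists_parallelogram_density F hF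
  have hint1 : ∀ g, Integrable (h g) ρ := fun g => by
    simpa using (hint g (fun _ => 1)).2 (integrable_const _)
  have hval1 : ∀ g, ∫ x, h g x ∂ρ = (F g).real Set.univ := fun g => by
    simpa using hval g (fun _ => 1)
  have hstep : ∀ᵐ x ∂ρ, ∀ (n : Fin d → ℕ) (i : Fin d),
      x i * (h (single n 1 + single 0 1) x - h (single n 1 - single 0 1) x) =
        h (single (n + Pi.single i 1) 1 + single 0 1) x -
          h (single (n + Pi.single i 1) 1 - single 0 1) x := by
    refine ae_all_iff.2 fun n => ae_all_iff.2 fun i => ?_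
    set p : (Fin d → ℕ) →₀ ℤ := single n 1
    set q : (Fin d → ℕ) →₀ ℤ := single (n + Pi.single i 1) 1
    let I : (Fin d → ℝ) → ℝ := fun x => 4 * (h p x * x i ^ 2) -
      2 * (h (p + q) x * x i - h (p - q) x * x i) + 4 * h q x
    have hI0 : 0 ≤ᵐ[ρ] I := by
      filter_upwards [hpar] with x hx
      have := parallelogramForm_ternary_nonneg (h := fun g => h g x) hx (fun g => hnn g x)
        p q 0 (x i) (-1) 0
      simp only [parallelogramForm_apply] at this
      simp only [Pi.zero_apply, I]
      refine this.trans (le_of_eq ?_)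
      ring
    have j1 := ((hint p (fun x => x i ^ 2)).2 (hi2 p i)).const_mul 4
    have j2 := (hint (p + q) (fun x => x i)).2 (hi1 _ i)
    have j3 := (hint (p - q) (fun x => x i)).2 (hi1 _ i)
    have j4 := (hint1 q).const_mul 4
    have j5 := (j2.sub j3).const_mul 2
    have hI : Integrable I ρ := (j1.sub j5).add j4
    have hIval : ∫ x, I x ∂ρ ≤ 0 := by
      refine le_trans (le_of_eq ?_) (hnull n i)
      have k1 : ∫ x, I x ∂ρ = ∫ x, (4 * (h p x * x i ^ 2) -
        2 * (h (p + q) x * x i - h (p - q) x * x i)) ∂ρ + ∫ x, 4 * h q x ∂ρ :=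
        integral_add (j1.sub j5) j4
      have k2 : ∫ x, (4 * (h p x * x i ^ 2) -
        2 * (h (p + q) x * x i - h (p - q) x * x i)) ∂ρ = ∫ x, 4 * (h p x * x i ^ 2) ∂ρ -
          ∫ x, 2 * (h (p + q) x * x i - h (p - q) x * x i) ∂ρ := integral_sub j1 j5
      rw [k1, k2, integral_const_mul, integral_const_mul, integral_const_mul,
        integral_sub j2 j3, hval p (fun x => x i ^ 2), hval (p + q) (fun x => x i),
        hval (p - q) (fun x => x i), hval1]
    have hIae := (integral_eq_zero_iff_of_nonneg_ae hI0 hI).1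
      (le_antisymm hIval (integral_nonneg_of_ae hI0))
    filter_upwards [hpar, hIae] with x hx hIx
    refine parallelogramForm_eq_of_null (h := fun g => h g x) (p := p) (q := q) hx
      (fun g => hnn g x) ?_ (single 0 1)
    rw [parallelogramForm_apply]
    simp only [Pi.zero_apply, I] at hIx
    rw [← hIx]
    ring
  have hall : ∀ᵐ x ∂ρ, ∀ n : Fin d → ℕ,
      h (single n 1 + single 0 1) x - h (single n 1 - single 0 1) x =
        4 * (h (single 0 1) x * ∏ i, x i ^ n i) := by
    filter_upwards [hpar, hstep] with x hx hs n
    have base : h (single 0 1 + single 0 1) x - h (single 0 1 - single 0 1) x =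
        4 * h (single 0 1) x := parallelogramForm_self (h := fun g => h g x) hx _
    induction hk : ∑ i, n i generalizing n with
    | zero =>
      have hn : n = 0 := funext fun i =>
        (Finset.sum_eq_zero_iff_of_nonneg (fun _ _ => Nat.zero_le _)).1 hk i (Finset.mem_univ i)
      subst hn
      simpa using base
    | succ k ih =>
      obtain ⟨i, -, hi⟩ : ∃ i ∈ Finset.univ, n i ≠ 0 :=
        Finset.exists_ne_zero_of_sum_ne_zero (by rw [hk]; exact k.succ_ne_zero)
      obtain ⟨n', rfl⟩ : ∃ n' : Fin d → ℕ, n = n' + Pi.single i 1 := by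
        refine ⟨n - Pi.single i 1, funext fun j => ?_⟩
        rcases eq_or_ne j i with rfl | hj
        · simp; omega
        · simp [hj]
      have hk' : ∑ j, n' j = k := by
        simp only [Pi.add_apply, Finset.sum_add_distrib, Finset.sum_pi_single', Finset.mem_univ,
          if_true] at hk
        simpa using hk
      rw [← hs n' i, ih n' hk']
      have : ∏ j, x j ^ (n' + Pi.single i 1 : Fin d → ℕ) j = x i * ∏ j, x j ^ n' j := by
        simp only [Pi.add_apply, pow_add, Finset.prod_mul_distrib]
        rw [mul_comm]
        congr 1
        rw [Finset.prod_eq_single i]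
        · simp
        · intro j _ hj; simp [hj]
        · simp
      rw [this]
      ring
  have hb : Integrable (fun x => h (single n 1 + single 0 1) x - h (single n 1 - single 0 1) x) ρ :=
    (hint1 _).sub (hint1 _)
  have hae : (fun x => h (single n 1 + single 0 1) x - h (single n 1 - single 0 1) x) =ᵐ[ρ]
      fun x => 4 * (h (single 0 1) x * ∏ i, x i ^ n i) := hall.mono fun x hx => hx n
  constructor
  · rw [← hint]
    have := (hb.congr hae).const_mul (4⁻¹ : ℝ)
    simpa using this
  · rw [← hval, ← integral_const_mul, ← integral_congr_ae hae, integral_sub (hint1 _) (hint1 _),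
      hval1, hval1]

end WeakLimits

theorem rmom_add {d : ℕ} (x : Fin d → ℝ) (m n : Fin d → ℕ) :
    rmom x (m + n) = rmom x m * rmom x n := by
  simp only [rmom, Pi.add_apply, pow_add, Finset.prod_mul_distrib]

theorem rmom_eq_ofReal {d : ℕ} (x : Fin d → ℝ) (n : Fin d → ℕ) :
    rmom x n = ((∏ i, x i ^ n i : ℝ) : ℂ) := by
  simp [rmom]

theorem conj_rmom {d : ℕ} (x : Fin d → ℝ) (n : Fin d → ℕ) :
    (starRingEnd ℂ) (rmom x n) = rmom x n := by
  rw [rmom_eq_ofReal, conj_ofReal]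

theorem continuous_rmom {d : ℕ} (n : Fin d → ℕ) : Continuous fun x : Fin d → ℝ => rmom x n := by
  unfold rmom
  fun_prop

/-- The polynomial function with coefficients `ξ`. -/
def polyFun {d : ℕ} (ξ : (Fin d → ℕ) →₀ ℂ) (x : Fin d → ℝ) : ℂ :=
  ξ.sum fun k z => rmom x k * z

theorem continuous_polyFun {d : ℕ} (ξ : (Fin d → ℕ) →₀ ℂ) : Continuous (polyFun ξ) := by
  unfold polyFun Finsupp.sum
  exact continuous_finsetSum _ fun k _ => (continuous_rmom k).mul continuous_const

theorem polyFun_add {d : ℕ} (ξ η : (Fin d → ℕ) →₀ ℂ) (x : Fin d → ℝ) :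
    polyFun (ξ + η) x = polyFun ξ x + polyFun η x :=
  Finsupp.sum_add_index' (fun _ => mul_zero _) fun _ _ _ => mul_add _ _ _

theorem polyFun_sub {d : ℕ} (ξ η : (Fin d → ℕ) →₀ ℂ) (x : Fin d → ℝ) :
    polyFun (ξ - η) x = polyFun ξ x - polyFun η x :=
  Finsupp.sum_sub_index fun _ _ _ => mul_sub _ _ _

theorem rmom_mul_normSq_polyFun {d : ℕ} (ξ : (Fin d → ℕ) →₀ ℂ) (n : Fin d → ℕ)
    (x : Fin d → ℝ) :
    ((normSq (polyFun ξ x) : ℝ) : ℂ) * rmom x n =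
      ∑ k ∈ ξ.support, ∑ l ∈ ξ.support, rmom x (n + k + l) * ξ k * (starRingEnd ℂ) (ξ l) := by
  rw [← mul_conj, polyFun, Finsupp.sum, map_sum, Finset.sum_mul_sum, Finset.sum_mul]
  refine Finset.sum_congr rfl fun k _ => ?_
  rw [Finset.sum_mul]
  refine Finset.sum_congr rfl fun l _ => ?_
  rw [map_mul, conj_rmom, rmom_add, rmom_add]
  ring

/-- The sesquilinear form attached to a multisequence, shifted by `n`. -/
def momentForm {d : ℕ} (a : (Fin d → ℕ) → ℂ) (n : Fin d → ℕ) (ξ η : (Fin d → ℕ) →₀ ℂ) : ℂ :=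
  ξ.sum fun k z => η.sum fun l w => a (n + k + l) * z * (starRingEnd ℂ) w

section MomentForm

variable {d : ℕ} (a : (Fin d → ℕ) → ℂ) (n : Fin d → ℕ) (ξ η ζ : (Fin d → ℕ) →₀ ℂ)

theorem aXi_eq_momentForm : aXi a ξ n = momentForm a n ξ ξ := rfl

theorem momentForm_add_left :
    momentForm a n (ξ + η) ζ = momentForm a n ξ ζ + momentForm a n η ζ :=
  Finsupp.sum_add_index' (fun _ => by simp) fun _ _ _ => by
    simp only [mul_add, add_mul, Finsupp.sum, Finset.sum_add_distrib]

theorem momentForm_sub_left :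
    momentForm a n (ξ - η) ζ = momentForm a n ξ ζ - momentForm a n η ζ :=
  Finsupp.sum_sub_index fun _ _ _ => by
    simp only [mul_sub, sub_mul, Finsupp.sum, Finset.sum_sub_distrib]

theorem momentForm_add_right :
    momentForm a n ζ (ξ + η) = momentForm a n ζ ξ + momentForm a n ζ η := by
  unfold momentForm
  rw [← Finsupp.sum_add]
  refine Finsupp.sum_congr fun k _ => ?_
  exact Finsupp.sum_add_index' (fun _ => by simp) fun _ _ _ => by rw [map_add, mul_add]

theorem momentForm_sub_right :
    momentForm a n ζ (ξ - η) = momentForm a n ζ ξ - momentForm a n ζ η := by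
  unfold momentForm
  rw [← Finsupp.sum_sub]
  refine Finsupp.sum_congr fun k _ => ?_
  exact Finsupp.sum_sub_index fun _ _ _ => by rw [map_sub, mul_sub]

theorem momentForm_single (k l : Fin d → ℕ) :
    momentForm a n (single k 1) (single l 1) = a (n + k + l) := by
  simp [momentForm]

theorem aXi_parallelogram :
    aXi a (ξ + η) n + aXi a (ξ - η) n = 2 * aXi a ξ n + 2 * aXi a η n := by
  simp only [aXi_eq_momentForm, momentForm_add_left, momentForm_add_right, momentForm_sub_left,
    momentForm_sub_right]
  ring

theorem aXi_single (k : Fin d → ℕ) : aXi a (single k 1) n = a (n + k + k) := by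
  rw [aXi_eq_momentForm, momentForm_single]

theorem aXi_single_polar (k l : Fin d → ℕ) :
    aXi a (single k 1 + single l 1) n - aXi a (single k 1 - single l 1) n =
      4 * a (n + k + l) := by
  simp only [aXi_eq_momentForm, momentForm_add_left, momentForm_add_right, momentForm_sub_left,
    momentForm_sub_right, momentForm_single, add_right_comm n l k]
  ring

end MomentForm

theorem exists_truncated_family_of_moment {d : ℕ} (a : (Fin d → ℕ) → ℂ)
    (μ : Measure (Fin d → ℝ))
    (hμ : ∀ n : Fin d → ℕ, Integrable (fun x => rmom x n) μ ∧ a n = ∫ x, rmom x n ∂μ) :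
    ∃ μ : ((Fin d → ℕ) →₀ ℂ) → Measure (Fin d → ℝ),
      (∀ ξ : (Fin d → ℕ) →₀ ℂ, ∀ n : Fin d → ℕ,
          Integrable (fun x => rmom x n) (μ ξ) ∧ aXi a ξ n = ∫ x, rmom x n ∂(μ ξ)) ∧
      μ 0 = 0 ∧
      (∀ ξ η : (Fin d → ℕ) →₀ ℂ, ∀ σ : Set (Fin d → ℝ), MeasurableSet σ →
          2 * μ η σ ≤ μ (ξ + η) σ + μ (ξ - η) σ) := by
  have hmeas : ∀ ξ : (Fin d → ℕ) →₀ ℂ,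
      Measurable fun x => ENNReal.ofReal (normSq (polyFun ξ x)) := fun ξ =>
    ENNReal.measurable_ofReal.comp
      (continuous_normSq.comp (continuous_polyFun ξ)).measurable
  refine ⟨fun ξ => μ.withDensity fun x => ENNReal.ofReal (normSq (polyFun ξ x)),
    fun ξ n => ?_, ?_, fun ξ η σ hσ => ?_⟩
  · have hfin : ∀ᵐ x ∂μ, ENNReal.ofReal (normSq (polyFun ξ x)) < ⊤ :=
      Filter.Eventually.of_forall fun x => ENNReal.ofReal_lt_top
    have hterm : ∀ k l, Integrable
        (fun x => rmom x (n + k + l) * ξ k * (starRingEnd ℂ) (ξ l)) μ := fun k l =>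
      ((hμ (n + k + l)).1.mul_const _).mul_const _
    have hfun : (fun x => (ENNReal.ofReal (normSq (polyFun ξ x))).toReal • rmom x n) =
        fun x => ∑ k ∈ ξ.support, ∑ l ∈ ξ.support,
          rmom x (n + k + l) * ξ k * (starRingEnd ℂ) (ξ l) := by
      funext x
      rw [ENNReal.toReal_ofReal (normSq_nonneg _), real_smul, rmom_mul_normSq_polyFun]
    constructor
    · rw [integrable_withDensity_iff_integrable_smul' (hmeas ξ) hfin, hfun]
      exact integrable_finsetSum _ fun k _ => integrable_finsetSum _ fun l _ => hterm k l
    · rw [integral_withDensity_eq_integral_toReal_smul (hmeas ξ) hfin, hfun,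
        integral_finsetSum _ fun k _ => integrable_finsetSum _ fun l _ => hterm k l]
      refine Finset.sum_congr rfl fun k _ => ?_
      rw [integral_finsetSum _ fun l _ => hterm k l]
      refine Finset.sum_congr rfl fun l _ => ?_
      rw [integral_mul_const, integral_mul_const, ← (hμ _).2]
  · have : (fun x : Fin d → ℝ => ENNReal.ofReal (normSq (polyFun 0 x))) = 0 := by
      funext x
      simp [polyFun]
    beta_reduce
    rw [this, withDensity_zero]
  · rw [withDensity_apply _ hσ, withDensity_apply _ hσ, withDensity_apply _ hσ,
      ← lintegral_const_mul _ (hmeas η), ← lintegral_add_left (hmeas _)]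
    refine lintegral_mono fun x => ?_
    rw [← ENNReal.ofReal_add (normSq_nonneg _) (normSq_nonneg _),
      show (2 : ENNReal) = ENNReal.ofReal 2 by simp, ← ENNReal.ofReal_mul (by norm_num),
      polyFun_add, polyFun_sub]
    refine ENNReal.ofReal_le_ofReal ?_
    simp only [normSq_apply, add_re, add_im, sub_re, sub_im]
    nlinarith [sq_nonneg (polyFun ξ x).re, sq_nonneg (polyFun ξ x).im]

theorem exists_moment_of_truncated_family {d : ℕ} (a : (Fin d → ℕ) → ℂ)
    (μ : ((Fin d → ℕ) →₀ ℂ) → Measure (Fin d → ℝ))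
    (hμ : ∀ ξ : (Fin d → ℕ) →₀ ℂ, ∀ n : Fin d → ℕ, truncIdx n →
      Integrable (fun x => rmom x n) (μ ξ) ∧ aXi a ξ n = ∫ x, rmom x n ∂(μ ξ))
    (hconv : ∀ ξ η : (Fin d → ℕ) →₀ ℂ, ∀ σ : Set (Fin d → ℝ), MeasurableSet σ →
      2 * μ η σ ≤ μ (ξ + η) σ + μ (ξ - η) σ) :
    ∃ μ : Measure (Fin d → ℝ), ∀ n : Fin d → ℕ,
      Integrable (fun x => rmom x n) μ ∧ a n = ∫ x, rmom x n ∂μ := by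
  have hre : ∀ (κ : Measure (Fin d → ℝ)) (n : Fin d → ℕ),
      ∫ x, rmom x n ∂κ = ((∫ x, ∏ i, x i ^ n i ∂κ : ℝ) : ℂ) := fun κ n => by
    simp only [rmom_eq_ofReal]
    exact integral_ofReal
  have hire : ∀ (κ : Measure (Fin d → ℝ)) (n : Fin d → ℕ),
      Integrable (fun x => rmom x n) κ ↔ Integrable (fun x => ∏ i, x i ^ n i) κ := fun κ n => by
    simp only [rmom_eq_ofReal]
    refine ⟨fun h => ?_, fun h => h.ofReal⟩
    have := h.re
    simp only [RCLike.re_to_complex, ofReal_re] at this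
    exact this
  have prod0 : ∀ x : Fin d → ℝ, ∏ i, x i ^ (0 : Fin d → ℕ) i = 1 := fun x => by simp
  have prod1 : ∀ (i : Fin d) (k : ℕ) (x : Fin d → ℝ),
      ∏ j, x j ^ (Pi.single i k : Fin d → ℕ) j = x i ^ k := fun i k x => by
    rw [Finset.prod_eq_single i]
    · simp
    · intro j _ hj
      simp [hj]
    · simp
  have t0 : truncIdx (0 : Fin d → ℕ) := Or.inl (by simp)
  have t1 : ∀ i : Fin d, truncIdx (Pi.single i 1 : Fin d → ℕ) := fun i => Or.inl (by simp)
  have t2 : ∀ i : Fin d, truncIdx (Pi.single i 2 : Fin d → ℕ) := fun i =>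
    Or.inr ⟨Pi.single i 1, by simp, by
      funext j
      rcases eq_or_ne j i with rfl | hj
      · simp
      · simp [hj]⟩
  have hfin : ∀ ξ, IsFiniteMeasure (μ ξ) := fun ξ => by
    have h := (hire _ _).1 (hμ ξ 0 t0).1
    simp only [prod0] at h
    exact (integrable_const_iff_isFiniteMeasure one_ne_zero).1 h
  have v0 : ∀ ξ, aXi a ξ 0 = (((μ ξ).real Set.univ : ℝ) : ℂ) := fun ξ => by
    rw [(hμ ξ 0 t0).2, hre]
    simp only [prod0, integral_const, smul_eq_mul, mul_one]
  have v1 : ∀ ξ i, aXi a ξ (Pi.single i 1) = ((∫ x, x i ∂(μ ξ) : ℝ) : ℂ) := fun ξ i => by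
    rw [(hμ ξ _ (t1 i)).2, hre]
    simp only [prod1, pow_one]
  have v2 : ∀ ξ i, aXi a ξ (Pi.single i 2) = ((∫ x, x i ^ 2 ∂(μ ξ) : ℝ) : ℂ) := fun ξ i => by
    rw [(hμ ξ _ (t2 i)).2, hre]
    simp only [prod1]
  have i1 : ∀ ξ i, Integrable (fun x : Fin d → ℝ => x i) (μ ξ) := fun ξ i => by
    simpa only [prod1, pow_one] using (hire _ _).1 (hμ ξ _ (t1 i)).1
  have i2 : ∀ ξ i, Integrable (fun x : Fin d → ℝ => x i ^ 2) (μ ξ) := fun ξ i => by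
    simpa only [prod1] using (hire _ _).1 (hμ ξ _ (t2 i)).1
  have hle : ∀ η, μ η ≤ μ (-η) := fun η => by
    refine Measure.le_iff.2 fun σ hσ => ?_
    have h := hconv 0 η σ hσ
    rw [zero_add, zero_sub, two_mul] at h
    exact (ENNReal.add_le_add_iff_left (measure_ne_top _ _)).1 h
  have heven : ∀ η, μ (-η) = μ η := fun η =>
    le_antisymm (by simpa using hle (-η)) (hle η)
  let ι : ((Fin d → ℕ) →₀ ℤ) →+ ((Fin d → ℕ) →₀ ℂ) :=
    Finsupp.mapRange.addMonoidHom (Int.castAddHom ℂ)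
  have hι : ∀ n : Fin d → ℕ, ι (single n 1) = single n 1 := fun n => by
    simp [ι]
  obtain ⟨F, hFfin, hFpar, hF0, hF12⟩ := exists_parallelogram_family (fun g => μ (ι g))
    (fun ξ η => by
      refine Measure.le_iff.2 fun σ hσ => ?_
      have h := hconv (ι ξ) (ι η) σ hσ
      rw [two_mul, ← neg_sub (ι η) (ι ξ), heven, add_comm (ι ξ)] at h
      simpa only [map_add, map_sub, Measure.coe_add, Pi.add_apply] using h)
    (fun g i => i1 _ i) (fun g i => i2 _ i)
    (fun ξ η => by
      have h := aXi_parallelogram a 0 (ι ξ) (ι η)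
      simp only [v0] at h
      simp only [map_add, map_sub]
      exact_mod_cast h)
    (fun i ξ η => by
      have h := aXi_parallelogram a (Pi.single i 1) (ι ξ) (ι η)
      simp only [v1] at h
      simp only [map_add, map_sub]
      exact_mod_cast h)
    (fun i ξ η => by
      have h := aXi_parallelogram a (Pi.single i 2) (ι ξ) (ι η)
      simp only [v2] at h
      simp only [map_add, map_sub]
      exact_mod_cast h)
  have hnull : ∀ (n : Fin d → ℕ) (i : Fin d),
      4 * ∫ x, x i ^ 2 ∂(F (single n 1)) -
        2 * (∫ x, x i ∂(F (single n 1 + single (n + Pi.single i 1) 1)) -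
          ∫ x, x i ∂(F (single n 1 - single (n + Pi.single i 1) 1))) +
        4 * (F (single (n + Pi.single i 1) 1)).real Set.univ ≤ 0 := by
    intro n i
    have h2 := (hF12 (single n 1) i).2.2.2
    rw [(hF12 (single n 1 + single (n + Pi.single i 1) 1) i).2.1,
      (hF12 (single n 1 - single (n + Pi.single i 1) 1) i).2.1, hF0]
    simp only [map_add, map_sub, hι] at h2 ⊢
    have e2 := aXi_single a (Pi.single i 2) n
    have e1 := aXi_single_polar a (Pi.single i 1) n (n + Pi.single i 1)
    have e0 := aXi_single a 0 (n + Pi.single i 1)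
    have s : (Pi.single i 2 : Fin d → ℕ) = Pi.single i 1 + Pi.single i 1 := by
      rw [← Pi.single_add]
    rw [show Pi.single i 1 + n + (n + Pi.single i 1) = Pi.single i 2 + n + n by rw [s]; abel,
      ← e2, v1, v1, v2] at e1
    rw [show 0 + (n + Pi.single i 1) + (n + Pi.single i 1) = Pi.single i 2 + n + n by
      rw [s]; abel, ← e2, v0, v2] at e0
    have e0' := ofReal_injective e0
    have e1' : ∫ x, x i ∂(μ (single n 1 + single (n + Pi.single i 1) 1)) -
        ∫ x, x i ∂(μ (single n 1 - single (n + Pi.single i 1) 1)) =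
          4 * ∫ x, x i ^ 2 ∂(μ (single n 1)) := by exact_mod_cast e1
    linarith
  refine ⟨F (single 0 1), fun n => ?_⟩
  obtain ⟨hn, hn'⟩ := moments_of_parallelogram_family F hFpar (fun g i => (hF12 g i).1)
    (fun g i => (hF12 g i).2.2.1) hnull n
  refine ⟨(hire _ _).2 hn, ?_⟩
  rw [hre]
  rw [hF0, hF0, map_add, map_sub, hι, hι] at hn'
  have e := aXi_single_polar a 0 n 0
  rw [v0, v0, ← ofReal_sub, hn', zero_add, add_zero] at e
  push_cast at e
  exact (mul_left_cancel₀ (by norm_num : (4 : ℂ) ≠ 0) e).symm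

/-- A `d`-multisequence is a moment multisequence iff there is a family of positive
Borel measures solving the utmost truncations `N₁ ∪ 2N₁` and satisfying
`μ_0 = 0`, `μ_{ξ+η} + μ_{ξ-η} - 2μ_η ≥ 0`. -/
theorem moment_iff_truncated_family (d : ℕ) (hd : 1 ≤ d) (a : (Fin d → ℕ) → ℂ) :
    (∃ μ : Measure (Fin d → ℝ), ∀ n : Fin d → ℕ,
        Integrable (fun x => rmom x n) μ ∧ a n = ∫ x, rmom x n ∂μ) ↔
    (∃ μ : ((Fin d → ℕ) →₀ ℂ) → Measure (Fin d → ℝ),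
        (∀ ξ : (Fin d → ℕ) →₀ ℂ, ∀ n : Fin d → ℕ, truncIdx n →
            Integrable (fun x => rmom x n) (μ ξ) ∧ aXi a ξ n = ∫ x, rmom x n ∂(μ ξ)) ∧
        μ 0 = 0 ∧
        (∀ ξ η : (Fin d → ℕ) →₀ ℂ, ∀ σ : Set (Fin d → ℝ), MeasurableSet σ →
            2 * μ η σ ≤ μ (ξ + η) σ + μ (ξ - η) σ)) := by
  constructor
  · rintro ⟨μ, hμ⟩
    obtain ⟨κ, h1, h2, h3⟩ := exists_truncated_family_of_moment a μ hμ
    exact ⟨κ, fun ξ n _ => h1 ξ n, h2, h3⟩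
  · rintro ⟨μ, hμ, -, hconv⟩
    exact exists_moment_of_truncated_family a μ hμ hconv
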